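/- arXiv:1610.05730 — 4 statements merged into one kernel-verified Lean document; each statement's English description precedes it below -/
import Mathlib

section
/- (Duchet's theorem) If every directed cycle in a digraph D contains at least one symmetric arc, then D is kernel-perfect; in particular, D has a kernel. -/
open List

attribute [local instance] Classical.propDecidable

variable {V : Type*}

/-- `l` is the vertex list of a directed path from `u` to `v` in the digraph with arc
relation `A`: the vertices are pairwise distinct, consecutive vertices are joined by
arcs, the path starts at `u` and ends at `v`.  Its length (number of arcs) is
`l.length - 1`. -/
def IsPath (A : V → V → Prop) (u v : V) (l : List V) : Prop :=
  l.Nodup ∧ l.Chain' A ∧ l.head? = some u ∧ l.getLast? = some v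

/-- The arcs of a directed path given by its vertex list. -/
def pathArcs (l : List V) : List (V × V) := l.zip l.tail

/-- The distance from `u` to `v` in the digraph with arc relation `A`: the least number
of arcs on a directed `uv`-path, and `⊤` if there is no such path. -/
noncomputable def ddist (A : V → V → Prop) (u v : V) : ℕ∞ :=
  sInf {n : ℕ∞ | ∃ l : List V, IsPath A u v l ∧ (l.length : ℕ∞) = n + 1}

/-- The arcs of the directed cycle whose vertex list is `l` (consecutive pairs,
including the wrap-around arc from the last vertex to the first). -/
def cycleArcs (l : List V) : List (V × V) := l.zip (l.rotate 1)

/-- `l` is the vertex list of a directed cycle of the digraph with arc relation `A`;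
the length `‖l‖` of the cycle is `l.length`. -/
def IsCycle (A : V → V → Prop) (l : List V) : Prop :=
  2 ≤ l.length ∧ l.Nodup ∧ ∀ p ∈ cycleArcs l, A p.1 p.2

/-- The number of symmetric arcs of the cycle with vertex list `l`. -/
noncomputable def symCount (A : V → V → Prop) (l : List V) : ℕ :=
  (cycleArcs l).countP (fun p => decide (A p.2 p.1))

/-- The `m`-closure of a digraph: there is an arc from `u` to `v` iff `u ≠ v` and the
distance from `u` to `v` in `D` is at most `m`. -/
def mClosure (A : V → V → Prop) (m : ℕ) : V → V → Prop :=
  fun u v => u ≠ v ∧ ddist A u v ≤ (m : ℕ∞)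

/-- A set `S` is `k`-independent if the distance between any two distinct vertices of
`S` is at least `k`. -/
def KIndependent (A : V → V → Prop) (k : ℕ) (S : Set V) : Prop :=
  ∀ u ∈ S, ∀ v ∈ S, u ≠ v → (k : ℕ∞) ≤ ddist A u v

/-- A set `S` is `ℓ`-absorbent if every vertex outside `S` is at distance at most `ℓ`
from some vertex of `S`. -/
def LAbsorbent (A : V → V → Prop) (ℓ : ℕ) (S : Set V) : Prop :=
  ∀ u, u ∉ S → ∃ v ∈ S, ddist A u v ≤ (ℓ : ℕ∞)

/-- A `k`-kernel is a `k`-independent and `(k-1)`-absorbent set. -/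
def IsKKernel (A : V → V → Prop) (k : ℕ) (S : Set V) : Prop :=
  KIndependent A k S ∧ LAbsorbent A (k - 1) S

/-- A kernel is a `2`-kernel, i.e. an independent set that `1`-absorbs every vertex
outside of it. -/
def IsKernel (A : V → V → Prop) (S : Set V) : Prop := IsKKernel A 2 S

/-- A digraph is kernel-perfect if every induced subdigraph has a kernel. -/
def KernelPerfect (A : V → V → Prop) : Prop :=
  ∀ S : Set V, ∃ K : Set S, IsKernel (fun x y : S => A x.1 y.1) K

theorem ddist_le_one {W : Type*} (A : W → W → Prop) (u v : W) (hne : u ≠ v) (h : A u v) :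
    ddist A u v ≤ 1 := by
  apply sInf_le
  refine ⟨[u, v], ⟨by simp [hne], List.isChain_pair.mpr h, by simp, by simp⟩, ?_⟩
  norm_num

theorem two_le_ddist {W : Type*} (A : W → W → Prop) (u v : W) (hne : u ≠ v) (h : ¬ A u v) :
    2 ≤ ddist A u v := by
  apply le_sInf
  rintro n ⟨l, ⟨-, hc, hh, hl⟩, hn⟩
  match l, hc, hh, hl, hn with
  | [], _, hh, _, _ => simp at hh
  | [a], _, hh, hl, _ =>
    simp at hh hl
    exact absurd (hh.symm.trans hl) hne
  | [a, b], hc, hh, hl, _ =>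
    simp at hh hl
    subst hh hl
    exact absurd (List.isChain_pair.mp hc) h
  | a :: b :: c :: t, _, _, _, hn =>
    cases n with
    | top => exact le_top
    | coe n =>
      norm_cast at hn ⊢
      simp at hn
      omega

/-- A finite nonempty set has a sink for the asymmetric part. -/
theorem exists_sink [Fintype V] (A : V → V → Prop) (hloopless : Irreflexive A)
    (hcyc : ∀ l : List V, IsCycle A l → ∃ p ∈ cycleArcs l, A p.2 p.1)
    (s : Set V) (hs : s.Nonempty) : ∃ v ∈ s, ∀ w ∈ s, A v w → A w v := by
  by_contra! hcon
  have hcon' : ∀ x : s, ∃ y : s, A x y ∧ ¬ A y x := by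
    rintro ⟨x, hx⟩
    obtain ⟨w, hw, h1, h2⟩ := hcon x hx
    exact ⟨⟨w, hw⟩, h1, h2⟩
  choose f hf using hcon'
  obtain ⟨y, hy⟩ := hs
  obtain ⟨m, n, hmn, he⟩ := Finite.exists_ne_map_eq_of_infinite (fun n : ℕ => f^[n] ⟨y, hy⟩)
  obtain ⟨x, hx⟩ : ∃ x, x ∈ Function.periodicPts f := by
    wlog hlt : m < n generalizing m n
    · exact this n m hmn.symm he.symm (by omega)
    refine ⟨f^[m] ⟨y, hy⟩, n - m, by omega, ?_⟩
    change f^[n - m] (f^[m] _) = _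
    rw [← Function.iterate_add_apply, Nat.sub_add_cancel hlt.le]
    exact he.symm
  have hpos := Function.minimalPeriod_pos_of_mem_periodicPts hx
  set k := Function.minimalPeriod f x with hk
  have hk1 : k ≠ 1 := by
    intro h1
    have hfx : f x = x := Function.minimalPeriod_eq_one_iff_isFixedPt.mp (hk ▸ h1)
    have := (hf x).1
    rw [hfx] at this
    exact hloopless _ this
  let l : List V := (List.range k).map (fun i => ((f^[i] x : s) : V))
  have hlen : l.length = k := by simp [l]
  have harc : ∀ p ∈ cycleArcs l, A p.1 p.2 ∧ ¬ A p.2 p.1 := by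
    intro p hp
    obtain ⟨i, hi, rfl⟩ := List.getElem_of_mem hp
    have e1 : (cycleArcs l)[i].1 = f^[i] x := by
      simp [cycleArcs, l]
    have e2 : (cycleArcs l)[i].2 = f (f^[i] x) := by
      rw [← Function.iterate_succ_apply' f]
      simp only [cycleArcs, List.getElem_zip, List.getElem_rotate, l, List.getElem_map,
        List.getElem_range, List.length_map, List.length_range]
      rw [hk, Function.iterate_mod_minimalPeriod_eq]
    rw [e1, e2]
    exact hf _
  have hnd : l.Nodup := by
    refine List.Nodup.map_on ?_ List.nodup_range
    intro a ha b hb hab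
    rw [List.mem_range] at ha hb
    exact Function.iterate_injOn_Iio_minimalPeriod ha hb (Subtype.ext hab)
  obtain ⟨p, hp, h⟩ := hcyc l ⟨by omega, hnd, fun p hp => (harc p hp).1⟩
  exact (harc p hp).2 h

theorem exists_ker [Fintype V] (A : V → V → Prop) (hloopless : Irreflexive A)
    (hcyc : ∀ l : List V, IsCycle A l → ∃ p ∈ cycleArcs l, A p.2 p.1) (n : ℕ) :
    ∀ s : Set V, s.ncard ≤ n → ∃ K ⊆ s, (∀ u ∈ K, ∀ v ∈ K, ¬ A u v) ∧
      ∀ u ∈ s, u ∉ K → ∃ v ∈ K, A u v := by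
  induction n with
  | zero =>
    intro s hs
    have : s = ∅ := by
      rw [← Set.ncard_eq_zero (Set.toFinite s)]
      omega
    subst this
    exact ⟨∅, by simp⟩
  | succ n ih =>
    intro s hs
    rcases s.eq_empty_or_nonempty with rfl | hne
    · exact ⟨∅, by simp⟩
    obtain ⟨v, hv, hsink⟩ := exists_sink A hloopless hcyc s hne
    have hlt : ({w ∈ s | w ≠ v ∧ ¬ A w v} : Set V).ncard < s.ncard := by
      apply Set.ncard_lt_ncard _ (Set.toFinite s)
      refine ⟨fun w hw => hw.1, fun h => (h hv).2.1 rfl⟩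
    obtain ⟨K, hKs, hind, habs⟩ := ih {w ∈ s | w ≠ v ∧ ¬ A w v} (by omega)
    refine ⟨insert v K, ?_, ?_, ?_⟩
    · intro w hw
      rcases hw with rfl | hw
      · exact hv
      · exact (hKs hw).1
    · rintro a (rfl | ha) b (rfl | hb) hab
      · exact hloopless _ hab
      · exact (hKs hb).2.2 (hsink b (hKs hb).1 hab)
      · exact (hKs ha).2.2 hab
      · exact hind a ha b hb hab
    · intro u hu huK
      by_cases hA : A u v
      · exact ⟨v, Or.inl rfl, hA⟩
      · obtain ⟨w, hw, h⟩ := habs u ⟨hu, fun h => huK (Or.inl h), hA⟩ (fun h => huK (Or.inr h))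
        exact ⟨w, Or.inr hw, h⟩

theorem isKernel_of {W : Type*} (A : W → W → Prop) (K : Set W)
    (h1 : ∀ u ∈ K, ∀ v ∈ K, ¬ A u v) (h2 : ∀ u, u ∉ K → ∃ v ∈ K, A u v) : IsKernel A K := by
  refine ⟨fun u hu v hv hne => two_le_ddist A u v hne (h1 u hu v hv), fun u hu => ?_⟩
  obtain ⟨v, hv, h⟩ := h2 u hu
  refine ⟨v, hv, ?_⟩
  have hne : u ≠ v := fun e => hu (e ▸ hv)
  simpa using ddist_le_one A u v hne h

/-- **Duchet's theorem.**  If every directed cycle of the (finite, loopless) digraph `D`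
has at least one symmetric arc, then `D` is kernel-perfect; in particular `D` has a
kernel. -/
theorem duchet [Fintype V] (A : V → V → Prop) (hloopless : Irreflexive A)
    (hcyc : ∀ l : List V, IsCycle A l → ∃ p ∈ cycleArcs l, A p.2 p.1) :
    KernelPerfect A ∧ ∃ K : Set V, IsKernel A K := by
  constructor
  · intro S
    obtain ⟨K, hK, h1, h2⟩ := exists_ker A hloopless hcyc _ S le_rfl
    refine ⟨{x | x.1 ∈ K}, isKernel_of _ _ (fun u hu v hv => h1 _ hu _ hv) fun u hu => ?_⟩
    obtain ⟨v, hv, h⟩ := h2 u.1 u.2 hu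
    exact ⟨⟨v, hK hv⟩, hv, h⟩
  · obtain ⟨K, hK, h1, h2⟩ := exists_ker A hloopless hcyc _ Set.univ le_rfl
    exact ⟨K, isKernel_of A K h1 fun u hu => h2 u trivial hu⟩
end

section
/- Let k ≥ 2 be an integer and let D be a digraph such that every directed cycle C of D has at least ((k−2)/(k−1))·‖C‖ + 1 symmetric arcs. Let B be a directed cycle of the (k−1)-closure H = C^{k−1}(D). If the directed paths of D (each of length at most k−1) that give rise to the arcs of B not belonging to A(D) are mutually internally disjoint, then B has a symmetric arc in H. -/
open List

attribute [local instance] Classical.propDecidable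

variable {V : Type*}

/-- arcs of the walk from `x` through the list `l` to `y` -/
def warcs : V → List V → V → List (V × V)
  | x, [], y => [(x, y)]
  | x, b :: l, y => (x, b) :: warcs b l y

theorem warcs_append (x y z : V) (l m : List V) :
    warcs x (l ++ z :: m) y = warcs x l z ++ warcs z m y := by
  induction l generalizing x with
  | nil => rfl
  | cons a l ih => simp [warcs, ih]

theorem warcs_zip (x y : V) (l : List V) : (x :: l).zip (l ++ [y]) = warcs x l y := by
  induction l generalizing x with
  | nil => rfl
  | cons a l ih => simpa [warcs] using ih a

theorem cycleArcs_cons (x : V) (l : List V) : cycleArcs (x :: l) = warcs x l x := by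
  rw [← warcs_zip]; simp [cycleArcs]

theorem warcs_length (x y : V) (l : List V) : (warcs x l y).length = l.length + 1 := by
  induction l generalizing x with
  | nil => rfl
  | cons a l ih => simp [warcs, ih]

theorem warcs_chain (R : V → V → Prop) (x y : V) (l : List V) :
    List.IsChain R (x :: (l ++ [y])) ↔ ∀ p ∈ warcs x l y, R p.1 p.2 := by
  induction l generalizing x with
  | nil => simp [warcs]
  | cons a l ih =>
    rw [List.cons_append, List.isChain_cons_cons, ih]; simp only [warcs, List.forall_mem_cons]

theorem exists_split_of_not_nodup (l : List V) (h : ¬ l.Nodup) :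
    ∃ (x : V) (a b c : List V), l = a ++ x :: (b ++ x :: c) := by
  induction l with
  | nil => simp at h
  | cons y l ih =>
    by_cases hy : y ∈ l
    · obtain ⟨b, c, rfl⟩ := List.append_of_mem hy
      exact ⟨y, [], b, c, rfl⟩
    · obtain ⟨x, a, b, c, rfl⟩ := ih (fun hn => h (List.nodup_cons.2 ⟨hy, hn⟩))
      exact ⟨x, y :: a, b, c, rfl⟩

theorem closed_walk_neg (A : V → V → Prop) (hloopless : ∀ x, ¬ A x x) (w : V × V → ℚ)
    (hw : ∀ l : List V, IsCycle A l → ((cycleArcs l).map w).sum < 0) (n : ℕ) :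
    ∀ (x : V) (l : List V), l.length ≤ n → (∀ p ∈ warcs x l x, A p.1 p.2) →
      ((warcs x l x).map w).sum < 0 := by
  induction n with
  | zero =>
    intro x l hl h
    obtain rfl : l = [] := by simpa using hl
    exact absurd (h (x, x) (by simp [warcs])) (hloopless x)
  | succ n ih =>
    intro x l hl h
    by_cases hn : (x :: l).Nodup
    · rw [← cycleArcs_cons]
      apply hw
      refine ⟨?_, hn, by rwa [cycleArcs_cons]⟩
      cases l with
      | nil => exact absurd (h (x, x) (by simp [warcs])) (hloopless x)
      | cons a l => simp
    · obtain ⟨z, a, b, c, he⟩ := exists_split_of_not_nodup _ hn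
      cases a with
      | nil =>
        simp only [List.nil_append, List.cons.injEq] at he
        obtain ⟨rfl, rfl⟩ := he
        rw [warcs_append] at h ⊢
        simp only [List.length_append, List.length_cons] at hl
        have h1 := ih x b (by omega) (fun p hp => h p (List.mem_append_left _ hp))
        have h2 := ih x c (by omega) (fun p hp => h p (List.mem_append_right _ hp))
        rw [List.map_append, List.sum_append]
        linarith
      | cons y a =>
        simp only [List.cons_append, List.cons.injEq] at he
        obtain ⟨rfl, rfl⟩ := he
        rw [warcs_append, warcs_append] at h ⊢
        simp only [List.length_append, List.length_cons] at hl
        have h1 := ih z b (by omega) (fun p hp => h p (by simp [hp]))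
        have h2 := ih x (a ++ z :: c) (by simp; omega) (fun p hp => h p (by
          rw [warcs_append] at hp
          simp only [List.mem_append] at hp ⊢
          tauto))
        rw [warcs_append] at h2
        simp only [List.map_append, List.sum_append] at h2 ⊢
        linarith

theorem concat_walks (A : V → V → Prop) (w : V × V → ℚ) (y : V) (l : List V) :
    ∀ x : V, (∀ p ∈ warcs x l y, ∃ m, (∀ q ∈ warcs p.1 m p.2, A q.1 q.2) ∧
        0 ≤ ((warcs p.1 m p.2).map w).sum) →
      ∃ m, (∀ q ∈ warcs x m y, A q.1 q.2) ∧ 0 ≤ ((warcs x m y).map w).sum := by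
  induction l with
  | nil => intro x h; exact h (x, y) (by simp [warcs])
  | cons a l ih =>
    intro x h
    obtain ⟨m1, h1, h1'⟩ := h (x, a) (by simp [warcs])
    obtain ⟨m2, h2, h2'⟩ := ih a (fun p hp => h p (by simp [warcs, hp]))
    refine ⟨m1 ++ a :: m2, ?_, ?_⟩
    · intro q hq
      rw [warcs_append, List.mem_append] at hq
      exact hq.elim (h1 q) (h2 q)
    · rw [warcs_append, List.map_append, List.sum_append]
      exact add_nonneg h1' h2'

/-- weight of an arc -/
noncomputable def arcWt (A : V → V → Prop) (k : ℕ) (p : V × V) : ℚ :=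
  (if A p.2 p.1 then 0 else (k : ℚ) - 1) - 1

theorem arcWt_sum (A : V → V → Prop) (k : ℕ) (L : List (V × V)) :
    (L.map (arcWt A k)).sum =
      ((k : ℚ) - 1) * (L.length - (L.countP (fun p => decide (A p.2 p.1)) : ℕ)) - L.length := by
  induction L with
  | nil => simp
  | cons p L ih =>
    rw [List.map_cons, List.sum_cons, ih, List.countP_cons]
    by_cases h : A p.2 p.1 <;> simp [arcWt, h] <;> ring

theorem mClosure_of_path (A : V → V → Prop) (k : ℕ) (u v : V) (m : List V)
    (hnd : (u :: (m ++ [v])).Nodup) (hlen : m.length + 2 ≤ k)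
    (hs : ∀ q ∈ warcs u m v, A q.2 q.1) : mClosure A (k - 1) v u := by
  have hc := (warcs_chain (fun a b => A b a) u v m).2 hs
  have hr : (u :: (m ++ [v])).reverse = v :: (m.reverse ++ [u]) := by simp
  refine ⟨?_, ?_⟩
  · rintro rfl
    simp at hnd
  · refine le_trans (b := ((m.length + 1 : ℕ) : ℕ∞)) (sInf_le ?_) ?_
    · refine ⟨(u :: (m ++ [v])).reverse, ⟨List.nodup_reverse.2 hnd, ?_, ?_, ?_⟩, ?_⟩
      · exact List.isChain_reverse.2 hc
      · simp
      · rw [List.getLast?_reverse]; rfl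
      · simp
    · exact_mod_cast (by omega : m.length + 1 ≤ k - 1)

theorem seg_weight (A : V → V → Prop) (k : ℕ) (u v : V) (m : List V)
    (hnd : (u :: (m ++ [v])).Nodup) (hlen : m.length + 2 ≤ k)
    (hs : ¬ mClosure A (k - 1) v u) : 0 ≤ ((warcs u m v).map (arcWt A k)).sum := by
  have hlt : (warcs u m v).countP (fun p => decide (A p.2 p.1)) < (warcs u m v).length := by
    refine lt_of_le_of_ne List.countP_le_length (fun he => hs ?_)
    apply mClosure_of_path A k u v m hnd hlen
    simpa using List.countP_eq_length.1 he
  rw [arcWt_sum]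
  have h1 : (((warcs u m v).countP (fun p => decide (A p.2 p.1)) : ℕ) : ℚ) + 1 ≤
      (warcs u m v).length := by exact_mod_cast hlt
  have h2 : ((warcs u m v).length : ℚ) + 1 ≤ k := by
    rw [warcs_length]; exact_mod_cast hlen
  have h3 : (0 : ℚ) ≤ (k : ℚ) - 1 := by
    have : (0 : ℚ) ≤ ((warcs u m v).length : ℚ) := Nat.cast_nonneg _
    linarith
  nlinarith

/-- Let `k ≥ 2` and let `D` be a digraph in which every directed cycle `C` has at least
`(k-2)/(k-1)·‖C‖ + 1` symmetric arcs.  Let `B` be a directed cycle of the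
`(k-1)`-closure `H` of `D` and, for every arc of `B` that is not an arc of `D`, choose
a directed path of `D` of length at most `k-1` giving rise to it.  If these paths are
mutually internally disjoint, then `B` has a symmetric arc in `H`. -/
theorem closure_cycle_symmetric_arc_of_disjoint_paths [Fintype V] (A : V → V → Prop)
    (hloopless : Irreflexive A) (k : ℕ) (hk : 2 ≤ k)
    (hcyc : ∀ l : List V, IsCycle A l →
      ((k : ℚ) - 2) / ((k : ℚ) - 1) * l.length + 1 ≤ (symCount A l : ℚ))
    (B : List V) (hB : IsCycle (mClosure A (k - 1)) B)
    (T : V × V → List V)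
    (hT : ∀ p ∈ cycleArcs B, ¬ A p.1 p.2 →
      IsPath A p.1 p.2 (T p) ∧ (T p).length ≤ k)
    (hdisj : ∀ p ∈ cycleArcs B, ∀ q ∈ cycleArcs B, p ≠ q →
      ¬ A p.1 p.2 → ¬ A q.1 q.2 → ∀ x ∈ (T p).tail.dropLast, x ∉ T q) :
    ∃ p ∈ cycleArcs B, mClosure A (k - 1) p.2 p.1 := by
  by_contra hno
  push Not at hno
  have hk' : (0 : ℚ) < (k : ℚ) - 1 := by
    have : (2 : ℚ) ≤ k := by exact_mod_cast hk
    linarith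
  have hw : ∀ l : List V, IsCycle A l → ((cycleArcs l).map (arcWt A k)).sum < 0 := by
    intro l hl
    have h := hcyc l hl
    rw [arcWt_sum]
    have hlen : (cycleArcs l).length = l.length := by simp [cycleArcs]
    rw [hlen]
    change _ ≤ (((cycleArcs l).countP (fun p => decide (A p.2 p.1)) : ℕ) : ℚ) at h
    have h2 := mul_le_mul_of_nonneg_left h hk'.le
    have h3 : ((k : ℚ) - 1) * (((k : ℚ) - 2) / ((k : ℚ) - 1) * l.length + 1) =
        ((k : ℚ) - 2) * l.length + ((k : ℚ) - 1) := by
      field_simp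
    rw [h3] at h2
    linarith
  cases B with
  | nil => simp [IsCycle] at hB
  | cons b B =>
    have hB3 := hB.2.2
    rw [cycleArcs_cons] at hno hT hB3
    obtain ⟨m, hm, hm'⟩ := concat_walks A (arcWt A k) b B b (by
      rintro ⟨u, v⟩ hp
      have hne : u ≠ v := (hB3 _ hp).1
      by_cases hA : A u v
      · refine ⟨[], by simpa [warcs] using hA, ?_⟩
        exact seg_weight A k u v [] (by simpa using hne) (by simpa using hk) (hno _ hp)
      · obtain ⟨⟨hnd, hch, hh, hl⟩, hlen⟩ := hT _ hp hA
        obtain ⟨m, hm⟩ : ∃ m, T (u, v) = u :: (m ++ [v]) := by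
          obtain ⟨t, ht⟩ := List.head?_eq_some_iff.1 hh
          rw [ht] at hl
          rcases List.eq_nil_or_concat t with rfl | ⟨m, z, rfl⟩
          · simp at hl; exact absurd hl hne
          · rw [List.concat_eq_append] at hl ht
            rw [← List.cons_append, List.getLast?_concat] at hl
            have hl : z = v := by simpa using hl
            exact ⟨m, by rw [ht, hl]⟩
        rw [hm] at hnd hch hlen
        refine ⟨m, (warcs_chain A u v m).1 hch, ?_⟩
        exact seg_weight A k u v m hnd (by simp at hlen; omega) (hno _ hp))
    exact absurd (closed_walk_neg A hloopless _ hw m.length b m le_rfl hm) (not_lt.2 hm')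
end

section
/- For every integer k ≥ 3, the digraph H_k has no k-kernel. -/
open List

attribute [local instance] Classical.propDecidable

variable {V : Type*}

/-- The vertex set of the digraph `H_k`: three copies `v`, `u`, `w` of `{1, …, k-1}`
(indexed here by `Fin (k-1)`, with `i : Fin (k-1)` standing for the vertex with
subscript `i+1`), together with the six extra vertices `e_v, f_v, e_u, f_u, e_w, f_w`. -/
inductive HkV (k : ℕ) : Type
  | vv (i : Fin (k - 1)) : HkV k
  | uu (i : Fin (k - 1)) : HkV k
  | ww (i : Fin (k - 1)) : HkV k
  | ev : HkV k
  | fv : HkV k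
  | eu : HkV k
  | fu : HkV k
  | ew : HkV k
  | fw : HkV k

/-- The arc relation of the digraph `H_k`: the symmetric arcs between consecutive
vertices of each of the three paths, the arcs `(v_{k-1}, u_1)`, `(u_{k-1}, w_1)`,
`(w_{k-1}, v_1)`, and the pendant arcs `(s_{k-1}, e_s)`, `(e_s, f_s)` for
`s ∈ {v, u, w}`. -/
def HkAdj (k : ℕ) : HkV k → HkV k → Prop
  | .vv i, .vv j => j.val = i.val + 1 ∨ i.val = j.val + 1
  | .uu i, .uu j => j.val = i.val + 1 ∨ i.val = j.val + 1
  | .ww i, .ww j => j.val = i.val + 1 ∨ i.val = j.val + 1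
  | .vv i, .uu j => i.val = k - 2 ∧ j.val = 0
  | .uu i, .ww j => i.val = k - 2 ∧ j.val = 0
  | .ww i, .vv j => i.val = k - 2 ∧ j.val = 0
  | .vv i, .ev => i.val = k - 2
  | .uu i, .eu => i.val = k - 2
  | .ww i, .ew => i.val = k - 2
  | .ev, .fv => True
  | .eu, .fu => True
  | .ew, .fw => True
  | _, _ => False

/-- Reachability by a path with at most `n` arcs. -/
def HkReach {V : Type*} (A : V → V → Prop) (u v : V) (n : ℕ) : Prop :=
  ∃ l : List V, IsPath A u v l ∧ l.length ≤ n + 1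

theorem hkReach_refl {V : Type*} (A : V → V → Prop) (u : V) : HkReach A u u 0 :=
  ⟨[u], by simp [IsPath, List.Chain'], by simp⟩

theorem hkReach_step {V : Type*} {A : V → V → Prop} {u w v : V} {n : ℕ}
    (h : A u w) (hr : HkReach A w v n) : HkReach A u v (n + 1) := by
  obtain ⟨l, ⟨hn, hc, hh, hl⟩, hlen⟩ := hr
  by_cases hu : u ∈ l
  · obtain ⟨a, b, rfl⟩ := List.append_of_mem hu
    refine ⟨u :: b, ⟨?_, ?_, by simp, ?_⟩, ?_⟩
    · exact (List.nodup_append.1 hn).2.1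
    · exact List.IsChain.right_of_append hc
    · simpa [List.getLast?_append] using hl
    · simp at hlen ⊢; omega
  · cases l with
    | nil => simp at hh
    | cons x t =>
      simp at hh
      subst hh
      refine ⟨u :: x :: t, ⟨List.nodup_cons.2 ⟨hu, hn⟩, ?_, by simp, ?_⟩, ?_⟩
      · exact List.isChain_cons_cons.2 ⟨h, hc⟩
      · simpa [List.getLast?_cons_cons] using hl
      · simp at hlen ⊢; omega

theorem hkReach_ddist {V : Type*} {A : V → V → Prop} {u v : V} {n : ℕ}
    (h : HkReach A u v n) : ddist A u v ≤ (n : ℕ∞) := by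
  obtain ⟨l, hp, hlen⟩ := h
  have hpos : 0 < l.length := by
    rcases l with _ | ⟨x, t⟩
    · simp [IsPath] at hp
    · simp
  have h1 : ddist A u v ≤ ((l.length - 1 : ℕ) : ℕ∞) := by
    apply sInf_le
    refine ⟨l, hp, ?_⟩
    have : l.length = (l.length - 1) + 1 := by omega
    exact_mod_cast this
  refine h1.trans ?_
  have : l.length - 1 ≤ n := by omega
  exact_mod_cast this

theorem hk_chain_pot {V : Type*} {A : V → V → Prop} (φ : V → ℕ)
    (hφ : ∀ x y, A x y → φ y ≤ φ x + 1) :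
    ∀ (l : List V) (u v : V), l.Chain' A → l.head? = some u → l.getLast? = some v →
      φ v + 1 ≤ φ u + l.length := by
  intro l
  induction l with
  | nil => intro u v _ h; simp at h
  | cons x t ih =>
    intro u v hc hh hl
    simp at hh
    subst hh
    cases t with
    | nil => simp at hl; subst hl; simp
    | cons y t =>
      have hc' := List.isChain_cons_cons.1 hc
      have := ih y v hc'.2 (by simp) (by simpa [List.getLast?_cons_cons] using hl)
      have := hφ _ _ hc'.1
      simp at *
      omega

theorem hk_ddist_pot {V : Type*} {A : V → V → Prop} (φ : V → ℕ)
    (hφ : ∀ x y, A x y → φ y ≤ φ x + 1) {u v : V} {n : ℕ}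
    (h : ddist A u v ≤ (n : ℕ∞)) : φ v ≤ φ u + n := by
  by_contra hcon
  have h2 : ((n + 1 : ℕ) : ℕ∞) ≤ ddist A u v := by
    apply le_sInf
    rintro m ⟨l, ⟨_, hc, hh, hl⟩, hlen⟩
    have := hk_chain_pot φ hφ l u v hc hh hl
    induction m using ENat.recTopCoe with
    | top => exact le_top
    | coe m =>
      have hlen' : l.length = m + 1 := by exact_mod_cast hlen
      have : n + 1 ≤ m := by omega
      exact_mod_cast this
  have h3 := h2.trans h
  have : n + 1 ≤ n := by exact_mod_cast h3
  omega

theorem hk_core {V : Type*} (A : V → V → Prop) (k : ℕ) (hk : 3 ≤ k) (S : Set V)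
    (hS : IsKKernel A k S) (s : Fin (k - 1) → V) (e f t : V)
    (hs : ∀ i j : Fin (k - 1), j.val = i.val + 1 → A (s i) (s j))
    (hse : ∀ i : Fin (k - 1), i.val = k - 2 → A (s i) e)
    (hst : ∀ i : Fin (k - 1), i.val = k - 2 → A (s i) t)
    (hef : A e f) (hf : ∀ x, ¬ A f x)
    (hsf : ∀ i, s i ≠ f) (hne : e ≠ f) (hsne : ∀ i, s i ≠ t)
    (φ : V → ℕ) (hφ : ∀ x y, A x y → φ y ≤ φ x + 1)
    (hφ0 : ∀ i : Fin (k - 1), i.val = 0 → φ (s i) = 0)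
    (hφk : ∀ x, φ x ≤ k - 1 → (∃ i, x = s i) ∨ x = e ∨ x = t) :
    s ⟨0, by omega⟩ ∈ S ↔ t ∉ S := by
  obtain ⟨hI, hAb⟩ := hS
  have indep : ∀ u v n, u ∈ S → v ∈ S → u ≠ v → HkReach A u v n → n < k → False := by
    intro u v n hu hv huv hr hn
    have h := (hI u hu v hv huv).trans (hkReach_ddist hr)
    have : k ≤ n := by exact_mod_cast h
    omega
  have hfS : f ∈ S := by
    by_contra hfS
    obtain ⟨v, hv, hd⟩ := hAb f hfS
    classical
    have := hk_ddist_pot (A := A) (fun x => if x = f then 0 else k) (by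
      intro x y hxy
      by_cases hx : x = f
      · subst hx; exact absurd hxy (hf y)
      · simp only [hx, if_false]; split_ifs <;> omega) hd
    by_cases hvf : v = f
    · exact hfS (hvf ▸ hv)
    · simp [hvf] at this; omega
  have hEF : HkReach A e f 1 := hkReach_step hef (hkReach_refl A f)
  have heS : e ∉ S := fun h => indep e f 1 h hfS hne hEF (by omega)
  have reach : ∀ (y : V) (c : ℕ),
      (∀ i : Fin (k - 1), i.val = k - 2 → HkReach A (s i) y c) →
      ∀ d (i : Fin (k - 1)), i.val + d = k - 2 → HkReach A (s i) y (c + d) := by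
    intro y c hy d
    induction d with
    | zero => intro i hi; exact hy i (by omega)
    | succ d ih =>
      intro i hi
      exact hkReach_step (hs i ⟨i.val + 1, by omega⟩ rfl) (ih _ (by simp; omega))
  have hsS : ∀ i : Fin (k - 1), i.val ≠ 0 → s i ∉ S := by
    intro i hi h
    exact indep _ f (2 + (k - 2 - i.val)) h hfS (hsf i)
      (reach f 2 (fun j hj => hkReach_step (hse j hj) hEF) _ i (by omega)) (by omega)
  constructor
  · intro h ht
    exact indep _ t (1 + (k - 2)) h ht (hsne _)
      (reach t 1 (fun j hj => hkReach_step (hst j hj) (hkReach_refl A t)) _ _ (by simp))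
      (by omega)
  · intro ht
    by_contra h
    obtain ⟨v, hv, hd⟩ := hAb _ h
    have hp := hk_ddist_pot φ hφ hd
    rw [hφ0 _ rfl] at hp
    rcases hφk v (by omega) with ⟨i, rfl⟩ | rfl | rfl
    · by_cases hi : i.val = 0
      · have : i = ⟨0, by omega⟩ := Fin.ext hi
        exact h (this ▸ hv)
      · exact hsS i hi hv
    · exact heS hv
    · exact ht hv

/-- For every integer `k ≥ 3`, the digraph `H_k` has no `k`-kernel. -/
theorem Hk_has_no_kKernel (k : ℕ) (hk : 3 ≤ k) :
    ¬ ∃ S : Set (HkV k), IsKKernel (HkAdj k) k S := by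
  rintro ⟨S, hS⟩
  have h1 := hk_core (HkAdj k) k hk S hS .vv .ev .fv (.uu ⟨0, by omega⟩)
    (fun i j h => Or.inl h) (fun i h => h) (fun i h => ⟨h, rfl⟩) trivial
    (fun x h => by cases x <;> exact h) (by simp) (by simp) (by simp)
    (fun x => match x with
      | .vv i => i.val | .uu i => k - 1 + i.val | .ev => k - 1 | _ => k)
    (by rintro (i|i|i|_|_|_|_|_|_) (j|j|j|_|_|_|_|_|_) h <;> simp [HkAdj] at h ⊢ <;> omega)
    (fun i h => h)
    (by rintro (i|i|i|_|_|_|_|_|_) h <;> simp [Fin.ext_iff] at h ⊢ <;> omega)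
  have h2 := hk_core (HkAdj k) k hk S hS .uu .eu .fu (.ww ⟨0, by omega⟩)
    (fun i j h => Or.inl h) (fun i h => h) (fun i h => ⟨h, rfl⟩) trivial
    (fun x h => by cases x <;> exact h) (by simp) (by simp) (by simp)
    (fun x => match x with
      | .uu i => i.val | .ww i => k - 1 + i.val | .eu => k - 1 | _ => k)
    (by rintro (i|i|i|_|_|_|_|_|_) (j|j|j|_|_|_|_|_|_) h <;> simp [HkAdj] at h ⊢ <;> omega)
    (fun i h => h)
    (by rintro (i|i|i|_|_|_|_|_|_) h <;> simp [Fin.ext_iff] at h ⊢ <;> omega)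
  have h3 := hk_core (HkAdj k) k hk S hS .ww .ew .fw (.vv ⟨0, by omega⟩)
    (fun i j h => Or.inl h) (fun i h => h) (fun i h => ⟨h, rfl⟩) trivial
    (fun x h => by cases x <;> exact h) (by simp) (by simp) (by simp)
    (fun x => match x with
      | .ww i => i.val | .vv i => k - 1 + i.val | .ew => k - 1 | _ => k)
    (by rintro (i|i|i|_|_|_|_|_|_) (j|j|j|_|_|_|_|_|_) h <;> simp [HkAdj] at h ⊢ <;> omega)
    (fun i h => h)
    (by rintro (i|i|i|_|_|_|_|_|_) h <;> simp [Fin.ext_iff] at h ⊢ <;> omega)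
  tauto
end

section
/- For every integer k ≥ 3, every directed cycle B of the digraph H_k has at least ((k−2)/(k−1))·‖B‖ symmetric arcs. More precisely, every directed cycle of H_k of length greater than 2 equals the cycle C = (v_1,…,v_{k−1},u_1,…,u_{k−1},w_1,…,w_{k−1},v_1), which has length 3(k−1) and exactly 3(k−2) symmetric arcs. -/
open List

attribute [local instance] Classical.propDecidable

variable {V : Type*}

/-- The vertex list of the unique long cycle
`C = (v_1, …, v_{k-1}, u_1, …, u_{k-1}, w_1, …, w_{k-1}, v_1)` of `H_k`. -/
def HkCycle (k : ℕ) : List (HkV k) :=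
  ((List.finRange (k - 1)).map HkV.vv) ++ ((List.finRange (k - 1)).map HkV.uu) ++
    ((List.finRange (k - 1)).map HkV.ww)

/-- Linear enumeration of the vertices of the long cycle. -/
def hkc (k : ℕ) (j : ℕ) : HkV k :=
  if h : j < k - 1 then .vv ⟨j, h⟩
  else if h : j - (k - 1) < k - 1 then .uu ⟨j - (k - 1), h⟩
  else if h : j - 2 * (k - 1) < k - 1 then .ww ⟨j - 2 * (k - 1), h⟩
  else .ev

lemma hkc_adj (k : ℕ) (hk : 3 ≤ k) (p q : ℕ) (hp : p < 3 * (k - 1)) (hq : q < 3 * (k - 1)) :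
    HkAdj k (hkc k p) (hkc k q) ↔
      (q = p + 1 ∨ (p = q + 1 ∧ p ≠ k - 1 ∧ p ≠ 2 * (k - 1)) ∨ (p = 3 * (k - 1) - 1 ∧ q = 0)) := by
  unfold hkc
  split_ifs <;>
    first
    | omega
    | (simp only [HkAdj]; omega)
    | exact iff_of_false (fun h => h) (by omega)

lemma hkc_inj (k : ℕ) (p q : ℕ) (hp : p < 3 * (k - 1)) (hq : q < 3 * (k - 1))
    (h : hkc k p = hkc k q) : p = q := by
  unfold hkc at h
  split_ifs at h <;> simp at h <;> omega

lemma hkCycle_eq (k : ℕ) : HkCycle k = (List.range (3 * (k - 1))).map (hkc k) := by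
  apply List.ext_getElem
  · simp [HkCycle]; omega
  · intro i h1 h2
    simp only [List.length_map, List.length_range] at h2
    simp only [HkCycle, List.getElem_append, List.length_append, List.length_map,
      List.length_finRange, List.getElem_map, List.getElem_finRange, List.getElem_range, hkc]
    split_ifs <;> first | omega | (simp; try omega)

lemma exists_hkc (k : ℕ) (x : HkV k) (y z : HkV k) (h1 : HkAdj k x y) (h2 : HkAdj k y z) :
    ∃ p, p < 3 * (k - 1) ∧ x = hkc k p := by
  rcases x with i | i | i | _ | _ | _ | _ | _ | _
  · refine ⟨i, by omega, ?_⟩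
    simp [hkc]
  · refine ⟨i + (k - 1), by omega, ?_⟩
    simp [hkc]
  · refine ⟨i + 2 * (k - 1), by omega, ?_⟩
    unfold hkc
    split_ifs <;> first | omega | simp
  all_goals rcases y with i | i | i | _ | _ | _ | _ | _ | _ <;> simp [HkAdj] at h1 h2
 
lemma cycle_walk (N : ℕ) (p : ℕ → ℕ) (hN : ∀ i, p i < N)
    (hs : ∀ i, p (i + 1) = p i + 1 ∨ p i = p (i + 1) + 1 ∨ (p i = N - 1 ∧ p (i + 1) = 0))
    (h2 : ∀ i, p (i + 2) ≠ p i) : ∀ i, p i = (p 0 + i) % N := by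
  have nb : ¬ p 0 = p 1 + 1 := by
    intro h
    have hb : ∀ i, p i = p (i + 1) + 1 := by
      intro i
      induction i with
      | zero => exact h
      | succ i ih =>
        have := hs (i + 1); have := h2 i; have := hN i
        simp only [Nat.add_assoc, Nat.reduceAdd] at *
        omega
    have hd : ∀ i, p i + i = p 0 := by
      intro i
      induction i with
      | zero => rfl
      | succ i ih => have := hb i; omega
    have := hd (p 0 + 1)
    omega
  have hf : ∀ i, p (i + 1) = p i + 1 ∨ (p i = N - 1 ∧ p (i + 1) = 0) := by
    intro i
    induction i with
    | zero => have := hs 0; simp only [Nat.zero_add] at *; omega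
    | succ i ih =>
      have := hs (i + 1); have := h2 i; have := hN i
      simp only [Nat.add_assoc, Nat.reduceAdd] at *
      omega
  intro i
  induction i with
  | zero => exact (Nat.mod_eq_of_lt (hN 0)).symm
  | succ i ih =>
    rw [← Nat.add_assoc, Nat.add_mod, ← ih]
    have h0 := hN (i + 1)
    have h3 := hN i
    rcases hf i with h | ⟨h, h'⟩
    · rw [Nat.mod_eq_of_lt (a := 1) (by omega), ← h, Nat.mod_eq_of_lt h0]
    · rw [h', h]
      rcases Nat.lt_or_ge 1 N with h1 | h1
      · rw [Nat.mod_eq_of_lt h1, Nat.sub_add_cancel (by omega), Nat.mod_self]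
      · have : N = 1 := by omega
        subst this; simp

lemma isCycle_adj {W : Type*} {A : W → W → Prop} {B : List W} (h : IsCycle A B) (i : ℕ)
    (h1 : i % B.length < B.length) (h2 : (i + 1) % B.length < B.length) :
    A (B[i % B.length]) (B[(i + 1) % B.length]) := by
  have := h.2.2 (B[i % B.length], B[(i + 1) % B.length]) (by
    rw [cycleArcs, List.mem_iff_getElem]
    refine ⟨i % B.length, by simpa using h1, ?_⟩
    simp [List.getElem_rotate])
  exact this

lemma long_cycle (k : ℕ) (hk : 3 ≤ k) (B : List (HkV k)) (hB : IsCycle (HkAdj k) B)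
    (hL : 2 < B.length) : ∃ m : ℕ, B = (HkCycle k).rotate m := by
  have hlt : ∀ i, i % B.length < B.length := fun i => Nat.mod_lt _ (by omega)
  have hadj := fun i => isCycle_adj hB i (hlt i) (hlt (i + 1))
  have hex : ∀ i, ∃ p, p < 3 * (k - 1) ∧ B[i % B.length]'(hlt i) = hkc k p := fun i =>
    exists_hkc k _ _ _ (hadj i) (hadj (i + 1))
  choose p hp hpe using hex
  have hidx : ∀ i j, p i = p j → i % B.length = j % B.length := by
    intro i j h
    have : B[i % B.length]'(hlt i) = B[j % B.length]'(hlt j) := by rw [hpe, hpe, h]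
    exact (hB.2.1.getElem_inj_iff).1 this
  have hw := cycle_walk (3 * (k - 1)) p hp (by
    intro i
    have := hadj i
    rw [hpe, hpe, hkc_adj k hk _ _ (hp _) (hp _)] at this
    omega) (by
    intro i h
    have h3 : i + 2 ≡ i + 0 [MOD B.length] := hidx _ _ h
    have h4 : 2 ≡ 0 [MOD B.length] := Nat.ModEq.add_left_cancel' i h3
    have := Nat.le_of_dvd (by norm_num) ((Nat.modEq_zero_iff_dvd).1 h4)
    omega)
  have hd1 : B.length ∣ 3 * (k - 1) := by
    have := hidx (3 * (k - 1)) 0 (by rw [hw (3 * (k - 1)), hw 0]; simp)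
    simpa using Nat.dvd_of_mod_eq_zero (by simpa using this)
  have hd2 : 3 * (k - 1) ∣ B.length := by
    have h0 : p B.length = p 0 := by
      apply hkc_inj k _ _ (hp _) (hp _)
      rw [← hpe, ← hpe]; simp
    have h1 := hw B.length
    rw [h0] at h1
    have h2 : p 0 + 0 ≡ p 0 + B.length [MOD 3 * (k - 1)] := by
      unfold Nat.ModEq
      rw [Nat.add_zero, Nat.mod_eq_of_lt (hp 0)]
      exact h1
    exact (Nat.modEq_zero_iff_dvd).1 (Nat.ModEq.add_left_cancel' _ h2).symm
  have hlen := Nat.dvd_antisymm hd1 hd2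
  refine ⟨p 0, ?_⟩
  rw [hkCycle_eq]
  apply List.ext_getElem
  · simp [hlen]
  · intro i h1 h2
    have := hpe i
    simp only [Nat.mod_eq_of_lt h1] at this
    rw [this, hw i]
    simp [List.getElem_rotate, Nat.add_comm]

lemma arcs_eq (k : ℕ) : cycleArcs (HkCycle k) =
    (List.range (3 * (k - 1))).map (fun i => (hkc k i, hkc k ((i + 1) % (3 * (k - 1))))) := by
  rw [hkCycle_eq, cycleArcs]
  apply List.ext_getElem
  · simp
  · intro i h1 h2
    simp [List.getElem_rotate]

lemma hk_isCycle (k : ℕ) (hk : 3 ≤ k) : IsCycle (HkAdj k) (HkCycle k) := by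
  refine ⟨by rw [hkCycle_eq]; simp; omega, ?_, ?_⟩
  · rw [hkCycle_eq]
    refine List.Nodup.map_on ?_ List.nodup_range
    intro x hx y hy h
    exact hkc_inj k x y (by simpa using hx) (by simpa using hy) h
  · rw [arcs_eq]
    intro q hq
    rw [List.mem_map] at hq
    obtain ⟨i, hi, rfl⟩ := hq
    rw [List.mem_range] at hi
    have hm : (i + 1) % (3 * (k - 1)) < 3 * (k - 1) := Nat.mod_lt _ (by omega)
    dsimp only
    rw [hkc_adj k hk _ _ hi hm]
    rcases Nat.lt_or_ge (i + 1) (3 * (k - 1)) with h | h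
    · rw [Nat.mod_eq_of_lt h]; omega
    · have : i + 1 = 3 * (k - 1) := by omega
      rw [this, Nat.mod_self]; omega

lemma hk_symCount (k : ℕ) (hk : 3 ≤ k) : symCount (HkAdj k) (HkCycle k) = 3 * (k - 2) := by
  rw [symCount, arcs_eq, List.countP_map]
  have h1 : List.countP ((fun q : HkV k × HkV k => decide (HkAdj k q.2 q.1)) ∘
      fun i => (hkc k i, hkc k ((i + 1) % (3 * (k - 1))))) (List.range (3 * (k - 1))) =
      List.countP (fun i => decide (i + 1 ≠ k - 1 ∧ i + 1 ≠ 2 * (k - 1) ∧ i + 1 ≠ 3 * (k - 1)))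
        (List.range (3 * (k - 1))) := by
    apply List.countP_congr
    intro i hi
    rw [List.mem_range] at hi
    have hm : (i + 1) % (3 * (k - 1)) < 3 * (k - 1) := Nat.mod_lt _ (by omega)
    simp only [Function.comp, decide_eq_true_eq]
    rw [hkc_adj k hk _ _ hm hi]
    rcases Nat.lt_or_ge (i + 1) (3 * (k - 1)) with h | h
    · rw [Nat.mod_eq_of_lt h]; omega
    · have : i + 1 = 3 * (k - 1) := by omega
      rw [this, Nat.mod_self]; omega
  rw [h1]
  obtain ⟨t, rfl⟩ : ∃ t, k = t + 2 := ⟨k - 2, by omega⟩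
  have e : 3 * (t + 2 - 1) = (t + 1) + (t + 1) + (t + 1) := by omega
  rw [e, List.range_add, List.range_add, List.countP_append, List.countP_append,
    List.countP_map, List.countP_map, List.range_succ]
  simp only [List.countP_append, List.countP_singleton]
  have full : ∀ f : ℕ → Bool, (∀ i < t, f i = true) → List.countP f (List.range t) = t := by
    intro f hf
    rw [List.countP_eq_length.2 (by simpa using hf), List.length_range]
  rw [full, full, full]
  · have hh : (2 : ℕ) * (t + 1) = t + 1 + t + 1 := by ring
    have h3 : t + 1 + (t + 1) + t + 1 = t + 1 + (t + 1) + (t + 1) := by ring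
    simp [hh, h3]
    omega
  all_goals
    intro i hi
    simp only [Function.comp, decide_eq_true_eq]
    omega

lemma symCount_rotate {W : Type*} (A : W → W → Prop) (l : List W) (m : ℕ) :
    symCount A (l.rotate m) = symCount A l := by
  have : cycleArcs (l.rotate m) = (cycleArcs l).rotate m := by
    unfold cycleArcs
    rw [List.rotate_rotate, Nat.add_comm, ← List.rotate_rotate]
    exact (List.zipWith_rotate_distrib Prod.mk l (l.rotate 1) m (by simp)).symm
  rw [symCount, symCount, this]
  exact (List.rotate_perm _ _).countP_eq _

/-- For every `k ≥ 3`: every directed cycle `B` of `H_k` has at least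
`(k-2)/(k-1)·‖B‖` symmetric arcs; more precisely, every directed cycle of `H_k` of
length greater than `2` equals (up to rotation of its vertex list) the cycle
`C = (v_1, …, v_{k-1}, u_1, …, u_{k-1}, w_1, …, w_{k-1}, v_1)`, which is a cycle of
length `3(k-1)` with exactly `3(k-2)` symmetric arcs. -/
theorem Hk_cycles (k : ℕ) (hk : 3 ≤ k) :
    (∀ B : List (HkV k), IsCycle (HkAdj k) B →
      ((k : ℚ) - 2) / ((k : ℚ) - 1) * B.length ≤ (symCount (HkAdj k) B : ℚ)) ∧
    (∀ B : List (HkV k), IsCycle (HkAdj k) B → 2 < B.length →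
      ∃ m : ℕ, B = (HkCycle k).rotate m) ∧
    IsCycle (HkAdj k) (HkCycle k) ∧
    (HkCycle k).length = 3 * (k - 1) ∧
    symCount (HkAdj k) (HkCycle k) = 3 * (k - 2) := by
  have hlen : (HkCycle k).length = 3 * (k - 1) := by rw [hkCycle_eq]; simp
  refine ⟨?_, long_cycle k hk, hk_isCycle k hk, hlen, hk_symCount k hk⟩
  intro B hB
  have hk' : (3 : ℚ) ≤ k := by exact_mod_cast hk
  rcases Nat.lt_or_ge 2 B.length with h | h
  · obtain ⟨m, rfl⟩ := long_cycle k hk B hB h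
    rw [symCount_rotate, hk_symCount k hk, List.length_rotate, hlen]
    push_cast [Nat.cast_sub (show 1 ≤ k by omega), Nat.cast_sub (show 2 ≤ k by omega)]
    have : (k : ℚ) - 1 ≠ 0 := by linarith
    apply le_of_eq
    field_simp
  · have hl : B.length = 2 := le_antisymm h hB.1
    obtain ⟨a, b, rfl⟩ := List.length_eq_two.1 hl
    have hA := hB.2.2
    have h1 : HkAdj k a b := hA (a, b) (by simp [cycleArcs])
    have h2 : HkAdj k b a := hA (b, a) (by simp [cycleArcs])
    have hs : symCount (HkAdj k) [a, b] = 2 := by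
      simp [symCount, cycleArcs, h1, h2]
    rw [hs, hl]
    have : ((k : ℚ) - 2) / ((k : ℚ) - 1) ≤ 1 := by
      rw [div_le_one (by linarith)]; linarith
    push_cast
    linarith
end
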